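/- arXiv:2306.12747 — 8 statements merged into one kernel-verified Lean document; each statement's English description precedes it below -/
import Mathlib

section
/- Under interpolation and smoothness, the stochastic gradient variance is controlled by the optimality gap: for every w ∈ ℝⁿ, (1/M)∑_{i=1}^M ‖∇f_i(w)‖² ≤ 2·L_max·(f(w) − f*), where L_max = max_i L_i. -/
section Smooth

variable {E : Type*} [NormedAddCommGroup E] [InnerProductSpace ℝ E] [CompleteSpace E]

/-- The descent lemma: a function with `L`-Lipschitz gradient is bounded above by its quadratic
model. -/
theorem le_add_inner_gradient_add_of_gradient_lipschitz {f : E → ℝ} {L : ℝ}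
    (hf : Differentiable ℝ f)
    (hL : ∀ x y, ‖gradient f x - gradient f y‖ ≤ L * ‖x - y‖) (x v : E) :
    f (x + v) ≤ f x + inner ℝ (gradient f x) v + L / 2 * ‖v‖ ^ 2 := by
  let h : ℝ → ℝ := fun t =>
    f (x + t • v) - t * inner ℝ (gradient f x) v - L / 2 * ‖v‖ ^ 2 * t ^ 2
  have hd (t : ℝ) : HasDerivAt h (inner ℝ (gradient f (x + t • v)) v -
      inner ℝ (gradient f x) v - L * ‖v‖ ^ 2 * t) t := by
    have hline : HasDerivAt (fun t : ℝ => x + t • v) v t := by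
      simpa using ((hasDerivAt_id t).smul_const v).const_add x
    have hcomp := (hf (x + t • v)).hasGradientAt.hasFDerivAt.comp_hasDerivAt t hline
    rw [InnerProductSpace.toDual_apply_apply] at hcomp
    refine ((hcomp.sub ((hasDerivAt_id t).mul_const (inner ℝ (gradient f x) v))).sub
      (((hasDerivAt_id t).pow 2).const_mul (L / 2 * ‖v‖ ^ 2))).congr_deriv ?_
    simp
    ring
  have hanti : AntitoneOn h (Set.Icc 0 1) := by
    refine antitoneOn_of_deriv_nonpos (convex_Icc 0 1)
      (fun t _ => (hd t).continuousAt.continuousWithinAt)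
      (fun t _ => (hd t).differentiableAt.differentiableWithinAt) fun t ht => ?_
    rw [interior_Icc] at ht
    rw [(hd t).deriv, ← inner_sub_left, sub_nonpos]
    calc inner ℝ (gradient f (x + t • v) - gradient f x) v
        ≤ ‖gradient f (x + t • v) - gradient f x‖ * ‖v‖ := real_inner_le_norm _ _
      _ ≤ L * ‖x + t • v - x‖ * ‖v‖ := by gcongr; exact hL _ _
      _ = L * ‖v‖ ^ 2 * t := by
        rw [add_sub_cancel_left, norm_smul, Real.norm_of_nonneg ht.1.le]
        ring
  have h01 := hanti (Set.left_mem_Icc.2 zero_le_one) (Set.right_mem_Icc.2 zero_le_one) zero_le_one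
  simp only [h, one_smul, zero_smul, add_zero] at h01
  linarith

/-- The squared gradient norm of a smooth function is controlled by its optimality gap. -/
theorem sq_norm_gradient_le_of_gradient_lipschitz {f : E → ℝ} {L : ℝ}
    (hf : Differentiable ℝ f)
    (hL : ∀ x y, ‖gradient f x - gradient f y‖ ≤ L * ‖x - y‖) {z : E} (hz : ∀ x, f z ≤ f x)
    (w : E) : ‖gradient f w‖ ^ 2 ≤ 2 * L * (f w - f z) := by
  rcases lt_or_ge 0 L with hpos | hnonpos
  · have hdesc := (hz _).trans
      (le_add_inner_gradient_add_of_gradient_lipschitz hf hL w (-(L⁻¹ • gradient f w)))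
    rw [inner_neg_right, real_inner_smul_right, real_inner_self_eq_norm_sq, norm_neg, norm_smul,
      Real.norm_of_nonneg (inv_nonneg.2 hpos.le)] at hdesc
    have hscaled := mul_le_mul_of_nonneg_left hdesc (mul_nonneg zero_le_two hpos.le)
    field_simp at hscaled
    linarith
  · have hgz : gradient f z = 0 := by
      have hmin : IsLocalMin f z := Filter.Eventually.of_forall hz
      simp [gradient, hmin.fderiv_eq_zero]
    have hle := hL w z
    rw [hgz, sub_zero] at hle
    have hgw : ‖gradient f w‖ = 0 :=
      le_antisymm (hle.trans (mul_nonpos_of_nonpos_of_nonneg hnonpos (norm_nonneg _)))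
        (norm_nonneg _)
    rw [hgw] at hle ⊢
    rcases hnonpos.lt_or_eq with hneg | rfl
    · have hwz : w = z := by
        rw [← sub_eq_zero, ← norm_le_zero_iff]
        exact nonpos_of_mul_nonneg_right hle hneg
      simp [hwz]
    · simp

end Smooth


/-- Under interpolation and smoothness, the stochastic gradient variance is controlled by
the optimality gap: `(1/M) ∑ i, ‖∇f_i(w)‖² ≤ 2 L_max (f(w) - f*)`. -/
theorem variance_le_optimality_gap {n M : ℕ} (hM : 0 < M)
    (f : Fin M → EuclideanSpace ℝ (Fin n) → ℝ)
    (hdiff : ∀ i, Differentiable ℝ (f i))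
    (L : Fin M → ℝ)
    (hLip : ∀ i x y, ‖gradient (f i) x - gradient (f i) y‖ ≤ L i * ‖x - y‖)
    (Lmax : ℝ) (hLmax : IsGreatest (Set.range L) Lmax)
    (F : EuclideanSpace ℝ (Fin n) → ℝ)
    (hF : ∀ x, F x = (1 / (M : ℝ)) * ∑ i, f i x)
    (wstar : EuclideanSpace ℝ (Fin n)) (fstar : ℝ)
    -- interpolation: `w*` minimizes `F` and every `f_i`, with common optimal value `fstar`
    (hmin : ∀ i x, f i wstar ≤ f i x) (hFmin : ∀ x, F wstar ≤ F x)
    (hval : ∀ i, f i wstar = fstar) (hFval : F wstar = fstar)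
    (w : EuclideanSpace ℝ (Fin n)) :
    (1 / (M : ℝ)) * ∑ i, ‖gradient (f i) w‖ ^ 2 ≤ 2 * Lmax * (F w - fstar) := by
  have hgap : F w - fstar = (1 / (M : ℝ)) * ∑ i, (f i w - fstar) := by
    have hM' : (M : ℝ) ≠ 0 := by positivity
    rw [hF, Finset.sum_sub_distrib]
    simp
    field_simp
  rw [hgap, mul_left_comm, Finset.mul_sum _ _ (2 * Lmax)]
  gcongr with i
  refine (sq_norm_gradient_le_of_gradient_lipschitz (hdiff i) (hLip i) (hmin i) w).trans ?_
  rw [hval i]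
  have hi : L i ≤ Lmax := hLmax.2 (Set.mem_range_self i)
  have hnonneg : 0 ≤ f i w - fstar := sub_nonneg.2 (hval i ▸ hmin i w)
  gcongr
end

section
/- Deterministic one-step bound for the strongly convex rate: let g : ℝⁿ → ℝ be convex and differentiable with global minimizer w* and g(w*) = f*. Let ξ ∈ [0,1), Q ∈ [0, 1/(1−ξ)], C ∈ ℝ with C ≥ f*, let c ∈ (1/2, 1), 0 < η_min ≤ η ≤ η_max, define C' = max{(ξQ·C + g(w))/(ξQ + 1), g(w)}, and suppose w⁺ = w − η∇g(w) satisfies g(w⁺) ≤ C' − cη‖∇g(w)‖². Then, with a = η_min(2 − 1/c) and b = (1 + η_max/(a·c))·ξ, one has ‖w⁺ − w*‖² + a(C' − f*) ≤ ‖w − w*‖² + 2η_min·(g(w) − f* − ⟨∇g(w), w − w*⟩) + a·b·(C − f*). -/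
open RealInnerProductSpace

/-- The first-order characterization of convexity: a convex function lies above its tangents. -/
theorem ConvexOn.add_inner_gradient_le {E : Type*} [NormedAddCommGroup E]
    [InnerProductSpace ℝ E] [CompleteSpace E] {f : E → ℝ} {x : E}
    (hf : ConvexOn ℝ Set.univ f) (hx : DifferentiableAt ℝ f x) (y : E) :
    f x + ⟪gradient f x, y - x⟫ ≤ f y := by
  have hline : ConvexOn ℝ Set.univ (f ∘ AffineMap.lineMap (k := ℝ) x y) :=
    hf.comp_affineMap _
  have hder : HasDerivAt (f ∘ AffineMap.lineMap (k := ℝ) x y) ⟪gradient f x, y - x⟫ 0 := by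
    have h := hx.hasGradientAt.hasFDerivAt
    rw [← AffineMap.lineMap_apply_zero (k := ℝ) x y] at h
    simpa using h.comp_hasDerivAt (0 : ℝ) AffineMap.hasDerivAt_lineMap
  have h := hline.le_slope_of_hasDerivAt (Set.mem_univ _) (Set.mem_univ _) one_pos hder
  simp only [slope_def_field, Function.comp_apply, AffineMap.lineMap_apply_one,
    AffineMap.lineMap_apply_zero, sub_zero, div_one] at h
  linarith

/-- The Zhang–Hager nonmonotone term exceeds a lower bound `m` of `v` and `C` by at most
`(v - m) + ξ (C - m)`. -/
theorem max_convexComb_le {ξ Q C m : ℝ} (v : ℝ) (hξ0 : 0 ≤ ξ) (hξ1 : ξ < 1) (hQ0 : 0 ≤ Q)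
    (hQ1 : Q ≤ 1 / (1 - ξ)) (hv : 0 ≤ v - m) (hC : 0 ≤ C - m) :
    max ((ξ * Q * C + v) / (ξ * Q + 1)) v ≤ v + ξ * (C - m) := by
  have hξC : 0 ≤ ξ * (C - m) := mul_nonneg hξ0 hC
  have hQ : Q * (1 - ξ) ≤ 1 := (le_div_iff₀ (sub_pos.2 hξ1)).1 hQ1
  have hξQ : 0 ≤ ξ * Q := mul_nonneg hξ0 hQ0
  refine max_le ?_ (by linarith)
  rw [div_le_iff₀ (by linarith)]
  have h₁ := mul_le_mul_of_nonneg_right hQ hξC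
  have h₂ := mul_nonneg hξQ hv
  linarith

/-- Deterministic one-step bound for the strongly convex rate (per-sample inequality
underlying Theorem 1): with `C' = max {(ξQC + g(w))/(ξQ + 1), g(w)}`,
`w⁺ = w - η ∇g(w)` satisfying the nonmonotone sufficient-decrease condition,
`a = ηmin (2 - 1/c)` and `b = (1 + ηmax/(a c)) ξ`, one has
`‖w⁺ - w*‖² + a (C' - f*) ≤ ‖w - w*‖² + 2 ηmin (g(w) - f* - ⟪∇g(w), w - w*⟫) + a b (C - f*)`. -/
theorem one_step_bound_strongly_convex {n : ℕ}
    (g : EuclideanSpace ℝ (Fin n) → ℝ) (hg : Differentiable ℝ g)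
    (hconv : ConvexOn ℝ Set.univ g)
    (wstar : EuclideanSpace ℝ (Fin n)) (fstar : ℝ)
    (hmin : ∀ x, g wstar ≤ g x) (hval : g wstar = fstar)
    (ξ Q C c ηmin ηmax η a b : ℝ)
    (hξ0 : 0 ≤ ξ) (hξ1 : ξ < 1) (hQ0 : 0 ≤ Q) (hQ1 : Q ≤ 1 / (1 - ξ))
    (hCge : fstar ≤ C) (hc : 1 / 2 < c) (hc1 : c < 1)
    (hηmin : 0 < ηmin) (hηlb : ηmin ≤ η) (hηub : η ≤ ηmax)
    (w : EuclideanSpace ℝ (Fin n)) (C' : ℝ)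
    (hC' : C' = max ((ξ * Q * C + g w) / (ξ * Q + 1)) (g w))
    (hls : g (w - η • gradient g w) ≤ C' - c * η * ‖gradient g w‖ ^ 2)
    (ha : a = ηmin * (2 - 1 / c)) (hb : b = (1 + ηmax / (a * c)) * ξ) :
    ‖(w - η • gradient g w) - wstar‖ ^ 2 + a * (C' - fstar) ≤
      ‖w - wstar‖ ^ 2
        + 2 * ηmin * (g w - fstar - ⟪gradient g w, w - wstar⟫)
        + a * b * (C - fstar) := by
  have hD : 0 ≤ g w - fstar := by linarith [hmin w]
  have hI : g w - fstar ≤ ⟪gradient g w, w - wstar⟫ := by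
    have h := hconv.add_inner_gradient_le (hg w) wstar
    rw [← neg_sub w wstar, inner_neg_right] at h
    linarith
  have hK : 0 ≤ C - fstar := by linarith
  have hK' : C' - fstar ≤ (g w - fstar) + ξ * (C - fstar) := by
    have h := max_convexComb_le (g w) hξ0 hξ1 hQ0 hQ1 hD hK
    rw [hC']
    linarith
  have hc0 : 0 < c := by linarith
  have hη : 0 < η := by linarith
  have hinv : 1 / c < 2 := by rw [div_lt_iff₀ hc0]; linarith
  have ha0 : 0 < a := ha ▸ mul_pos hηmin (by linarith)
  have hG : η ^ 2 * ‖gradient g w‖ ^ 2 ≤ η / c * (C' - fstar) := by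
    have h : c * η * ‖gradient g w‖ ^ 2 ≤ C' - fstar := by
      linarith [hmin (w - η • gradient g w)]
    calc η ^ 2 * ‖gradient g w‖ ^ 2 = η / c * (c * η * ‖gradient g w‖ ^ 2) := by
          field_simp
      _ ≤ η / c * (C' - fstar) := by gcongr
  have hexp : ‖(w - η • gradient g w) - wstar‖ ^ 2 =
      ‖w - wstar‖ ^ 2 - 2 * η * ⟪gradient g w, w - wstar⟫
        + η ^ 2 * ‖gradient g w‖ ^ 2 := by
    rw [sub_right_comm, norm_sub_sq_real, inner_smul_right, real_inner_comm, norm_smul,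
      mul_pow, Real.norm_eq_abs, sq_abs]
    ring
  have hab : a * b = (a + ηmax / c) * ξ := by
    rw [hb]
    field_simp
  have hcoefD : η / c + a ≤ 2 * η := by
    have h : ηmin * (2 - 1 / c) ≤ η * (2 - 1 / c) := by gcongr
    rw [ha]
    calc η / c + ηmin * (2 - 1 / c) ≤ η / c + η * (2 - 1 / c) := by gcongr
      _ = 2 * η := by ring
  have hkey : (η / c + a) * (C' - fstar) ≤
      2 * η * (g w - fstar) + a * b * (C - fstar) := by
    calc (η / c + a) * (C' - fstar)
        ≤ (η / c + a) * ((g w - fstar) + ξ * (C - fstar)) := by gcongr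
      _ = (η / c + a) * (g w - fstar) + (a + η / c) * ξ * (C - fstar) := by ring
      _ ≤ 2 * η * (g w - fstar) + (a + ηmax / c) * ξ * (C - fstar) := by gcongr
      _ = 2 * η * (g w - fstar) + a * b * (C - fstar) := by rw [hab]
  have hstep := mul_le_mul_of_nonneg_left hI (sub_nonneg.2 hηlb)
  rw [hexp]
  linarith
end

section
/- Per-iteration averaged contraction for the strongly convex rate: assume interpolation, each f_i convex and differentiable, and f μ-strongly convex. Let ξ ∈ [0,1), Q ∈ [0, 1/(1−ξ)], C ∈ ℝ with C ≥ f*, c ∈ (1/2,1), 0 < η_min ≤ η_max, a = η_min(2 − 1/c), b = (1 + η_max/(a·c))·ξ, d = max{1 − η_min·μ, b}. Fix w ∈ ℝⁿ and for each i ∈ {1,…,M} let C^{(i)} = max{(ξQ·C + f_i(w))/(ξQ + 1), f_i(w)}, let η^{(i)} ∈ [η_min, η_max] satisfy f_i(w − η^{(i)}∇f_i(w)) ≤ C^{(i)} − c·η^{(i)}·‖∇f_i(w)‖², and set w^{(i)} = w − η^{(i)}∇f_i(w). Then (1/M)∑_{i=1}^M [ ‖w^{(i)} − w*‖² + a(C^{(i)}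 − f*) ] ≤ d·( ‖w − w*‖² + a(C − f*) ). -/
open scoped RealInnerProductSpace in
/-- First-order lower bound for a strongly convex function with a gradient. -/
theorem StrongConvexOn.add_inner_gradient_add_le {E : Type*} [NormedAddCommGroup E]
    [InnerProductSpace ℝ E] [CompleteSpace E] {s : Set E} {m : ℝ} {φ : E → ℝ} {g x y : E}
    (h : StrongConvexOn s m φ) (hg : HasGradientAt φ g x) (hx : x ∈ s) (hy : y ∈ s) :
    φ x + ⟪g, y - x⟫ + m / 2 * ‖y - x‖ ^ 2 ≤ φ y := by
  have hline : HasDerivAt (fun t : ℝ => x + t • (y - x)) (y - x) 0 := by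
    simpa using ((hasDerivAt_id (0 : ℝ)).smul_const (y - x)).const_add x
  have hφ : HasFDerivAt φ (InnerProductSpace.toDual ℝ E g) (x + (0 : ℝ) • (y - x)) := by
    simpa using hg.hasFDerivAt
  have hderiv : HasDerivAt (fun t : ℝ => φ (x + t • (y - x))) ⟪g, y - x⟫ 0 := by
    simpa [Function.comp_def] using hφ.comp_hasDerivAt (0 : ℝ) hline
  have hslope := hderiv.tendsto_slope_zero_right
  have hbound : Filter.Tendsto (fun t : ℝ => φ y - φ x - (1 - t) * (m / 2 * ‖y - x‖ ^ 2))
      (nhdsWithin 0 (Set.Ioi 0)) (nhds (φ y - φ x - (1 - 0) * (m / 2 * ‖y - x‖ ^ 2))) :=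
    (Continuous.tendsto (by fun_prop) 0).mono_left nhdsWithin_le_nhds
  have hle := le_of_tendsto_of_tendsto hslope hbound (by
    filter_upwards [Ioo_mem_nhdsGT (zero_lt_one (α := ℝ))] with t ht
    have hconv := h.2 hx hy (sub_nonneg.2 ht.2.le) ht.1.le (sub_add_cancel 1 t)
    have hpt : (1 - t) • x + t • y = x + t • (y - x) := by module
    rw [hpt, norm_sub_rev x y] at hconv
    simp only [smul_eq_mul, zero_add, zero_smul, add_zero] at hconv ⊢
    rw [inv_mul_le_iff₀ ht.1]
    linarith)
  linarith

/-- The nonmonotone reference value exceeds the current gap by at most a fraction `ξ` of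
the previous reference gap. -/
theorem nonmonotone_reference_gap_le {ξ Q C v m : ℝ} (hξ0 : 0 ≤ ξ) (hξ1 : ξ < 1)
    (hQ0 : 0 ≤ Q) (hQ1 : Q ≤ 1 / (1 - ξ)) (hC : m ≤ C) (hv : m ≤ v) :
    max ((ξ * Q * C + v) / (ξ * Q + 1)) v - m ≤ ξ * (C - m) + (v - m) := by
  have hξQ : 0 ≤ ξ * Q := mul_nonneg hξ0 hQ0
  have hQ : Q ≤ ξ * Q + 1 := by
    rw [le_div_iff₀ (sub_pos.2 hξ1)] at hQ1
    linarith
  rw [sub_le_iff_le_add]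
  refine max_le ?_ ?_
  · rw [div_le_iff₀ (by linarith)]
    have h₁ := mul_le_mul_of_nonneg_left hQ (mul_nonneg hξ0 (sub_nonneg.2 hC))
    have h₂ := mul_nonneg hξQ (sub_nonneg.2 hv)
    linarith
  · linarith [mul_nonneg hξ0 (sub_nonneg.2 hC)]

open scoped RealInnerProductSpace in
/-- One gradient step of length `η ≥ ηmin` accepted by the nonmonotone line search. -/
theorem line_search_step_le {E : Type*} [NormedAddCommGroup E] [InnerProductSpace ℝ E]
    {w z g : E} {η ηmin ηmax c ξ a e R Δ : ℝ} (hc : 1 / 2 < c) (hξ0 : 0 ≤ ξ)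
    (hηmin : 0 < ηmin) (hη : η ∈ Set.Icc ηmin ηmax) (ha : a = ηmin * (2 - 1 / c))
    (he : 0 ≤ e) (hΔ : 0 ≤ Δ) (hinner : e ≤ ⟪g, w - z⟫)
    (hls : c * η * ‖g‖ ^ 2 ≤ R) (hR : R ≤ ξ * Δ + e) :
    ‖(w - η • g) - z‖ ^ 2 + a * R ≤
      ‖w - z‖ ^ 2 - 2 * ηmin * (⟪g, w - z⟫ - e) + (1 + ηmax / (a * c)) * ξ * (a * Δ) := by
  have hc0 : 0 < c := by linarith
  have hη0 : 0 < η := hηmin.trans_le hη.1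
  have hc2 : 0 < 2 - 1 / c := by
    rw [sub_pos, div_lt_iff₀ hc0]
    linarith
  have ha0 : 0 < a := ha ▸ mul_pos hηmin hc2
  have hexpand : ‖(w - η • g) - z‖ ^ 2 =
      ‖w - z‖ ^ 2 - 2 * η * ⟪g, w - z⟫ + η ^ 2 * ‖g‖ ^ 2 := by
    rw [sub_right_comm, norm_sub_sq_real, inner_smul_right, real_inner_comm, norm_smul,
      mul_pow, Real.norm_eq_abs, sq_abs]
    ring
  have hgrad : η ^ 2 * ‖g‖ ^ 2 ≤ η / c * R := by
    calc η ^ 2 * ‖g‖ ^ 2 = η / c * (c * η * ‖g‖ ^ 2) := by field_simp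
      _ ≤ η / c * R := by gcongr
  have hcoef : (1 + ηmax / (a * c)) * ξ * (a * Δ) = (ηmax / c + a) * (ξ * Δ) := by
    field_simp
    ring
  have hdrop : 0 ≤ (η - ηmin) * (⟪g, w - z⟫ - e) :=
    mul_nonneg (sub_nonneg.2 hη.1) (sub_nonneg.2 hinner)
  have hmul : (η / c + a) * R ≤ (η / c + a) * (ξ * Δ + e) := by gcongr
  have hmax : (η / c + a) * (ξ * Δ) ≤ (ηmax / c + a) * (ξ * Δ) := by
    gcongr
    exact hη.2
  have hgap : (η / c + a) * e ≤ 2 * η * e := by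
    gcongr
    have := mul_le_mul_of_nonneg_right hη.1 hc2.le
    rw [ha, div_eq_mul_one_div η c]
    linarith
  rw [hexpand, hcoef]
  linarith

/-- Per-iteration averaged contraction for the strongly convex rate: averaging the
one-step Zhang–Hager nonmonotone line-search step over a uniformly sampled index `i`,
`(1/M) ∑ i, (‖w⁽ⁱ⁾ - w*‖² + a (C⁽ⁱ⁾ - f*)) ≤ d (‖w - w*‖² + a (C - f*))`,
where `d = max {1 - ηmin μ, b}`. -/
theorem averaged_contraction_strongly_convex {n M : ℕ} (hM : 0 < M)
    (f : Fin M → EuclideanSpace ℝ (Fin n) → ℝ)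
    (hdiff : ∀ i, Differentiable ℝ (f i))
    (hconv : ∀ i, ConvexOn ℝ Set.univ (f i))
    (F : EuclideanSpace ℝ (Fin n) → ℝ)
    (hF : ∀ x, F x = (1 / (M : ℝ)) * ∑ i, f i x)
    (μ : ℝ) (hμ : 0 < μ) (hsc : StrongConvexOn Set.univ μ F)
    (wstar : EuclideanSpace ℝ (Fin n)) (fstar : ℝ)
    -- interpolation: `w*` minimizes `F` and every `f_i`, with common optimal value `fstar`
    (hmin : ∀ i x, f i wstar ≤ f i x) (hFmin : ∀ x, F wstar ≤ F x)
    (hval : ∀ i, f i wstar = fstar) (hFval : F wstar = fstar)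
    (ξ Q C c ηmin ηmax a b d : ℝ)
    (hξ0 : 0 ≤ ξ) (hξ1 : ξ < 1) (hQ0 : 0 ≤ Q) (hQ1 : Q ≤ 1 / (1 - ξ))
    (hCge : fstar ≤ C) (hc : 1 / 2 < c) (hc1 : c < 1)
    (hηmin : 0 < ηmin) (hηminmax : ηmin ≤ ηmax)
    (ha : a = ηmin * (2 - 1 / c)) (hb : b = (1 + ηmax / (a * c)) * ξ)
    (hd : d = max (1 - ηmin * μ) b)
    (w : EuclideanSpace ℝ (Fin n)) (Ci η' : Fin M → ℝ)
    (hCi : ∀ i, Ci i = max ((ξ * Q * C + f i w) / (ξ * Q + 1)) (f i w))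
    (hη' : ∀ i, η' i ∈ Set.Icc ηmin ηmax)
    (hls : ∀ i, f i (w - η' i • gradient (f i) w) ≤
      Ci i - c * η' i * ‖gradient (f i) w‖ ^ 2) :
    (1 / (M : ℝ)) * ∑ i,
        (‖(w - η' i • gradient (f i) w) - wstar‖ ^ 2 + a * (Ci i - fstar)) ≤
      d * (‖w - wstar‖ ^ 2 + a * (C - fstar)) := by
  have hM' : (0 : ℝ) < M := Nat.cast_pos.2 hM
  have hgrad i : HasGradientAt (f i) (gradient (f i) w) w := (hdiff i w).hasGradientAt
  have hgradF : HasGradientAt F ((1 / (M : ℝ)) • ∑ i, gradient (f i) w) w := by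
    rw [show F = fun x => (1 / (M : ℝ)) * ∑ i, f i x from funext hF, hasGradientAt_iff_hasFDerivAt]
    simpa using (HasFDerivAt.fun_sum fun i _ => (hgrad i).hasFDerivAt).const_mul (1 / (M : ℝ))
  have hstrong : F w - fstar + μ / 2 * ‖w - wstar‖ ^ 2 ≤
      (1 / (M : ℝ)) * ∑ i, inner ℝ (gradient (f i) w) (w - wstar) := by
    have h := hsc.add_inner_gradient_add_le hgradF (Set.mem_univ w) (Set.mem_univ wstar)
    rw [hFval, ← neg_sub w wstar, norm_neg, inner_neg_right, real_inner_smul_left,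
      sum_inner] at h
    linarith
  have hinner i : f i w - fstar ≤ inner ℝ (gradient (f i) w) (w - wstar) := by
    have h := (strongConvexOn_zero.2 (hconv i)).add_inner_gradient_add_le (hgrad i)
      (Set.mem_univ w) (Set.mem_univ wstar)
    rw [hval, ← neg_sub w wstar, inner_neg_right] at h
    linarith
  have hle i (x) : fstar ≤ f i x := hval i ▸ hmin i x
  have hstep i : ‖(w - η' i • gradient (f i) w) - wstar‖ ^ 2 + a * (Ci i - fstar) ≤
      ‖w - wstar‖ ^ 2 -
        2 * ηmin * (inner ℝ (gradient (f i) w) (w - wstar) - (f i w - fstar)) +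
        b * (a * (C - fstar)) := by
    rw [hb]
    refine line_search_step_le hc hξ0 hηmin (hη' i) ha (sub_nonneg.2 (hle i w))
      (sub_nonneg.2 hCge) (hinner i) ?_ ?_
    · linarith [hls i, hle i (w - η' i • gradient (f i) w)]
    · rw [hCi]
      exact nonmonotone_reference_gap_le hξ0 hξ1 hQ0 hQ1 hCge (hle i w)
  have ha0 : 0 ≤ a := by
    rw [ha]
    refine mul_nonneg hηmin.le (sub_nonneg.2 ?_)
    rw [div_le_iff₀ (by linarith)]
    linarith
  calc _ ≤ (1 / (M : ℝ)) * ∑ i, (‖w - wstar‖ ^ 2 -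
        2 * ηmin * (inner ℝ (gradient (f i) w) (w - wstar) - (f i w - fstar)) +
        b * (a * (C - fstar))) := by
        exact mul_le_mul_of_nonneg_left (Finset.sum_le_sum fun i _ => hstep i) (by positivity)
    _ = ‖w - wstar‖ ^ 2 - 2 * ηmin * ((1 / (M : ℝ)) *
          ∑ i, inner ℝ (gradient (f i) w) (w - wstar) - (F w - fstar)) +
        b * (a * (C - fstar)) := by
        rw [hF]
        simp only [Finset.sum_add_distrib, Finset.sum_sub_distrib, ← Finset.mul_sum,
          Finset.sum_const, Finset.card_univ, Fintype.card_fin, nsmul_eq_mul]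
        field_simp
    _ ≤ (1 - ηmin * μ) * ‖w - wstar‖ ^ 2 + b * (a * (C - fstar)) := by
        have := mul_le_mul_of_nonneg_left hstrong hηmin.le
        linarith
    _ ≤ d * ‖w - wstar‖ ^ 2 + d * (a * (C - fstar)) := by
        have hC0 : 0 ≤ a * (C - fstar) := mul_nonneg ha0 (sub_nonneg.2 hCge)
        rw [hd]
        gcongr
        · exact le_max_left _ _
        · exact le_max_right _ _
    _ = _ := by ring
end

section
/- Theorem 1 (linear rate, strongly convex case): assume interpolation, each f_i convex and L_i-Lipschitz smooth, and f μ-strongly convex. Run SGD with the Zhang–Hager nonmonotone line search: i_0, i_1, … i.i.d. uniform on {1,…,M}; w_{k+1} = w_k − η_k∇f_{i_k}(w_k); C_k given by the Zhang–Hager recursion; and the step sizes satisfy η_k ∈ [η_min, η_max] and f_{i_k}(w_{k+1}) ≤ C_k − c·η_k·‖∇f_{i_k}(w_k)‖², where η_min = min{2δ(1−c)/L_max, η̄_min} with δ ∈ (0,1) and 0 < η̄_min ≤ η_max. If c > 1/2 and ξ < 1/(1 + η_max/(η_min(2c − 1))), then for all k ≥ 0, E[‖w_{k+1} − w*‖²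 + a(C_k − f*)] ≤ d^k·(‖w_0 − w*‖² + a(f(w_0) − f*)), where a = η_min(2 − 1/c) > 0, b = (1 + η_max/(a·c))·ξ ∈ (0,1), and d = max{1 − η_min·μ, b} ∈ (0,1). -/
/-- First-order lower bound for a strongly convex function (`m = 0` is plain convexity). -/
lemma StrongConvexOn.fderiv_lower_bound {E : Type*} [NormedAddCommGroup E] [NormedSpace ℝ E]
    {φ : E → ℝ} {m : ℝ} (hφ : StrongConvexOn Set.univ m φ) {φ' : E →L[ℝ] ℝ} {x : E}
    (hx : HasFDerivAt φ φ' x) (y : E) :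
    φ x + φ' (y - x) + m / 2 * ‖y - x‖ ^ 2 ≤ φ y := by
  have hline : HasDerivAt (fun t : ℝ => x + t • (y - x)) (y - x) 0 := by
    simpa using ((hasDerivAt_id (0 : ℝ)).smul_const (y - x)).const_add x
  have hderiv : HasDerivAt (fun t : ℝ => φ (x + t • (y - x))) (φ' (y - x)) 0 := by
    have hx' : HasFDerivAt φ φ' (x + (0 : ℝ) • (y - x)) := by simpa using hx
    exact hx'.comp_hasDerivAt (0 : ℝ) hline
  have hslope := hderiv.tendsto_slope.mono_left
    (nhdsWithin_mono (0 : ℝ) fun t (ht : t ∈ Set.Ioi 0) => ne_of_gt ht)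
  have hbound : Filter.Tendsto
      (fun t : ℝ => φ y - φ x - (1 - t) * (m / 2 * ‖y - x‖ ^ 2)) (nhdsWithin 0 (Set.Ioi 0))
      (nhds (φ y - φ x - (1 - 0) * (m / 2 * ‖y - x‖ ^ 2))) := by
    refine Filter.Tendsto.mono_left (Continuous.tendsto ?_ 0) nhdsWithin_le_nhds
    fun_prop
  have hle := le_of_tendsto_of_tendsto hslope hbound <| by
    filter_upwards [Ioo_mem_nhdsGT (zero_lt_one' ℝ)] with t ht
    have h := hφ.2 (Set.mem_univ x) (Set.mem_univ y) (sub_nonneg.2 ht.2.le) ht.1.le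
      (sub_add_cancel 1 t)
    have hpt : (1 - t) • x + t • y = x + t • (y - x) := by module
    rw [hpt, norm_sub_rev x y] at h
    simp only [smul_eq_mul] at h
    rw [slope_def_field, sub_zero, div_le_iff₀ ht.1]
    simp only [zero_smul, add_zero]
    nlinarith
  linarith

lemma ConvexOn.sub_le_inner_gradient {E : Type*} [NormedAddCommGroup E] [InnerProductSpace ℝ E]
    [CompleteSpace E] {φ : E → ℝ} (hφ : ConvexOn ℝ Set.univ φ) {x : E}
    (hx : DifferentiableAt ℝ φ x) (y : E) :
    φ x - φ y ≤ inner ℝ (gradient φ x) (x - y) := by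
  have h := (strongConvexOn_zero.2 hφ).fderiv_lower_bound hx.hasFDerivAt y
  rw [inner_gradient_left, ← neg_sub y x, map_neg]
  linarith

/-- An average of convex differentiable functions that is strongly convex: the average gap in the
first-order inequalities of the summands controls the squared distance. -/
lemma card_mul_sq_norm_le_sum_inner_gradient {E : Type*} [NormedAddCommGroup E]
    [InnerProductSpace ℝ E] [CompleteSpace E] {M : ℕ} (hM : 0 < M) {f : Fin M → E → ℝ}
    (hdiff : ∀ i, Differentiable ℝ (f i)) {F : E → ℝ}
    (hF : ∀ x, F x = (1 / (M : ℝ)) * ∑ i, f i x) {μ : ℝ} (hsc : StrongConvexOn Set.univ μ F)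
    (x y : E) :
    M * (μ / 2 * ‖x - y‖ ^ 2) ≤ ∑ i, (inner ℝ (gradient (f i) x) (x - y) - (f i x - f i y)) := by
  have hM' : (0 : ℝ) < M := by exact_mod_cast hM
  have hF' : HasFDerivAt F ((1 / (M : ℝ)) • ∑ i, fderiv ℝ (f i) x) x := by
    rw [funext hF]
    exact (HasFDerivAt.fun_sum fun i _ => (hdiff i x).hasFDerivAt).const_mul _
  have h := hsc.fderiv_lower_bound hF' y
  have hg : ∀ i, inner ℝ (gradient (f i) x) (x - y) = -(fderiv ℝ (f i) x (y - x)) := fun i => by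
    rw [inner_gradient_left, ← neg_sub y x, map_neg]
  simp only [hg, Finset.sum_sub_distrib, Finset.sum_neg_distrib]
  rw [hF, hF, norm_sub_rev] at h
  simp only [smul_apply, sum_apply, smul_eq_mul] at h
  have h2 := mul_le_mul_of_nonneg_left h hM'.le
  have e : ∀ z : ℝ, (M : ℝ) * (1 / (M : ℝ) * z) = z := fun z => by field_simp
  rw [mul_add, mul_add, e, e, e] at h2
  linarith

/-- One step of gradient descent whose step length is limited by the line-search condition. -/
lemma sq_norm_gradient_step_le {E : Type*} [NormedAddCommGroup E] [InnerProductSpace ℝ E]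
    {x g y : E} {t tmin tmax c a ξ Δ P R : ℝ} (hc : 1 / 2 < c) (htmin : 0 < tmin)
    (ht : t ∈ Set.Icc tmin tmax) (ha : a = tmin * (2 - 1 / c)) (hξ : 0 ≤ ξ) (hP : 0 ≤ P)
    (hΔ : 0 ≤ Δ) (hinner : Δ ≤ inner ℝ g (x - y)) (hR : R ≤ ξ * P + Δ)
    (hls : c * t * ‖g‖ ^ 2 ≤ R) :
    ‖x - t • g - y‖ ^ 2 + a * R ≤
      ‖x - y‖ ^ 2 - 2 * tmin * (inner ℝ g (x - y) - Δ) + (a + tmax / c) * ξ * P := by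
  have hc0 : 0 < c := by linarith
  have ht0 : 0 ≤ t := htmin.le.trans ht.1
  have hexp : ‖x - t • g - y‖ ^ 2
      = ‖x - y‖ ^ 2 - 2 * t * inner ℝ g (x - y) + t * (t * ‖g‖ ^ 2) := by
    rw [sub_right_comm, norm_sub_sq_real, inner_smul_right, real_inner_comm, norm_smul, mul_pow,
      Real.norm_eq_abs, sq_abs]
    ring
  have hcc : 1 / c < 2 := by rw [div_lt_iff₀ hc0]; linarith
  have ha0 : 0 ≤ a := by rw [ha]; exact mul_nonneg htmin.le (by linarith)
  have hg : t * ‖g‖ ^ 2 ≤ (1 / c) * R := by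
    rw [one_div, inv_mul_eq_div, le_div_iff₀ hc0]; linarith
  have h1 : t * (t * ‖g‖ ^ 2) ≤ t * ((1 / c) * R) := mul_le_mul_of_nonneg_left hg ht0
  have h2 : (a + t * (1 / c)) * R ≤ (a + t * (1 / c)) * (ξ * P + Δ) :=
    mul_le_mul_of_nonneg_left hR (by positivity)
  have h3 : t * (1 / c) * (ξ * P) ≤ tmax * (1 / c) * (ξ * P) :=
    mul_le_mul_of_nonneg_right (mul_le_mul_of_nonneg_right ht.2 (by positivity)) (by positivity)
  have h4 : 0 ≤ (t - tmin) * (inner ℝ g (x - y) - Δ) :=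
    mul_nonneg (sub_nonneg.2 ht.1) (sub_nonneg.2 hinner)
  have h5 : 0 ≤ (t - tmin) * ((2 - 1 / c) * Δ) :=
    mul_nonneg (sub_nonneg.2 ht.1) (mul_nonneg (by linarith) hΔ)
  have h6 : a * Δ = tmin * (2 - 1 / c) * Δ := by rw [ha]
  rw [hexp, div_eq_mul_one_div tmax c]
  nlinarith

/-- Extends a finite tuple of indices to a sequence, as in the averages of the main theorem. -/
abbrev extendTuple {α : Type*} (k : ℕ) (σ : Fin (k + 1) → α) : ℕ → α :=
  fun j => if h : j < k + 1 then σ ⟨j, h⟩ else σ ⟨0, Nat.succ_pos k⟩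

lemma extendTuple_snoc_of_le {α : Type*} {k j : ℕ} (τ : Fin (k + 1) → α) (i : α) (hj : j ≤ k) :
    extendTuple (k + 1) (Fin.snoc τ i : Fin (k + 2) → α) j = extendTuple k τ j := by
  have h1 : j < k + 1 := by omega
  have h2 : j < k + 1 + 1 := by omega
  simp [extendTuple, h1, h2, Fin.snoc]

lemma extendTuple_snoc_last {α : Type*} {k : ℕ} (τ : Fin (k + 1) → α) (i : α) :
    extendTuple (k + 1) (Fin.snoc τ i : Fin (k + 2) → α) (k + 1) = i := by
  simp [extendTuple, Fin.snoc]

lemma Fin.sum_pi_snoc {α : Type*} [Fintype α] {k : ℕ} (g : (Fin (k + 1) → α) → ℝ) :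
    ∑ σ, g σ = ∑ τ : Fin k → α, ∑ i, g (Fin.snoc τ i : Fin (k + 1) → α) := by
  rw [← (Fin.snocEquiv fun _ : Fin (k + 1) => α).sum_comp, Fintype.sum_prod_type_right]
  rfl

/-- A conditional contraction of the one-step average yields a geometric rate for the average
over all tuples. -/
lemma average_extendTuple_le_pow {M : ℕ} (hM : 0 < M) {V : (ℕ → Fin M) → ℕ → ℝ} {d B : ℝ}
    (hd : 0 ≤ d)
    (hzero : ∑ σ : Fin 1 → Fin M, V (extendTuple 0 σ) 0 ≤ M * B)
    (hstep : ∀ k (τ : Fin (k + 1) → Fin M),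
      ∑ i, V (extendTuple (k + 1) (Fin.snoc τ i : Fin (k + 2) → Fin M)) (k + 1) ≤
        M * (d * V (extendTuple k τ) k)) (k : ℕ) :
    (1 / (M : ℝ) ^ (k + 1)) * ∑ σ : Fin (k + 1) → Fin M, V (extendTuple k σ) k ≤ d ^ k * B := by
  have hM' : (0 : ℝ) < M := by exact_mod_cast hM
  rw [one_div, inv_mul_le_iff₀ (by positivity)]
  induction k with
  | zero => simpa using hzero
  | succ k ih =>
    rw [Fin.sum_pi_snoc fun σ => V (extendTuple (k + 1) σ) (k + 1)]
    calc _ ≤ ∑ τ : Fin (k + 1) → Fin M, M * (d * V (extendTuple k τ) k) :=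
          Finset.sum_le_sum fun τ _ => hstep k τ
      _ = M * d * ∑ τ : Fin (k + 1) → Fin M, V (extendTuple k τ) k := by
          rw [Finset.mul_sum]; exact Finset.sum_congr rfl fun _ _ => by ring
      _ ≤ M * d * ((M : ℝ) ^ (k + 1) * (d ^ k * B)) :=
          mul_le_mul_of_nonneg_left ih (by positivity)
      _ = _ := by ring

/-- The Zhang–Hager averaging step, measured from a lower bound `s` of the previous value and the
new value. -/
lemma zhang_hager_step_bounds {ξ q p v s : ℝ} (hξ0 : 0 ≤ ξ) (hq0 : 0 ≤ q)
    (hq : q ≤ ξ * q + 1) (hp : s ≤ p) (hv : s ≤ v) :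
    max ((ξ * q * p + v) / (ξ * q + 1)) v - s ≤ ξ * (p - s) + (v - s) := by
  have hpos : 0 < ξ * q + 1 := by positivity
  have hps : 0 ≤ ξ * (p - s) := mul_nonneg hξ0 (sub_nonneg.2 hp)
  rw [sub_le_iff_le_add]
  refine max_le ?_ (by linarith)
  rw [div_le_iff₀ hpos]
  nlinarith [mul_nonneg hps (sub_nonneg.2 hq),
    mul_nonneg (mul_nonneg hξ0 hq0) (sub_nonneg.2 hv)]

/-- Theorem 1 (linear rate, strongly convex case) for SGD with the Zhang–Hager
nonmonotone line search under interpolation.  The stochastic process is indexed by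
the sequence of sampled indices `ω : ℕ → Fin M`; `η` is adapted (it depends only on
the indices drawn so far), and the expectation at step `k` is the uniform average
over all tuples of the first `k+1` indices.  The conclusion states
`E[‖w_{k+1} - w*‖² + a (C_k - f*)] ≤ d^k (‖w_0 - w*‖² + a (f(w_0) - f*))`. -/
theorem sgd_zhang_hager_linear_rate_strongly_convex {n M : ℕ} (hM : 0 < M)
    (f : Fin M → EuclideanSpace ℝ (Fin n) → ℝ)
    (hdiff : ∀ i, Differentiable ℝ (f i))
    (hconv : ∀ i, ConvexOn ℝ Set.univ (f i))
    (L : Fin M → ℝ)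
    (hLip : ∀ i x y, ‖gradient (f i) x - gradient (f i) y‖ ≤ L i * ‖x - y‖)
    (Lmax : ℝ) (hLmax : IsGreatest (Set.range L) Lmax)
    (F : EuclideanSpace ℝ (Fin n) → ℝ)
    (hF : ∀ x, F x = (1 / (M : ℝ)) * ∑ i, f i x)
    (μ : ℝ) (hμ : 0 < μ) (hsc : StrongConvexOn Set.univ μ F)
    (wstar : EuclideanSpace ℝ (Fin n)) (fstar : ℝ)
    -- interpolation: `w*` minimizes `F` and every `f_i`, with common optimal value `fstar`
    (hmin : ∀ i x, f i wstar ≤ f i x) (hFmin : ∀ x, F wstar ≤ F x)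
    (hval : ∀ i, f i wstar = fstar) (hFval : F wstar = fstar)
    (ξ c δ ηbarmin ηmax ηmin a b d : ℝ)
    (hξ0 : 0 ≤ ξ) (hξ1 : ξ < 1)
    (hc : 1 / 2 < c) (hc1 : c < 1) (hδ : δ ∈ Set.Ioo (0 : ℝ) 1)
    (hηbarmin : 0 < ηbarmin) (hηbarmax : ηbarmin ≤ ηmax)
    (hηmin : ηmin = min (2 * δ * (1 - c) / Lmax) ηbarmin)
    (hξsmall : ξ < 1 / (1 + ηmax / (ηmin * (2 * c - 1))))
    (ha : a = ηmin * (2 - 1 / c)) (hb : b = (1 + ηmax / (a * c)) * ξ)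
    (hd : d = max (1 - ηmin * μ) b)
    -- the stochastic process: iterates, step sizes and nonmonotone terms
    (w : (ℕ → Fin M) → ℕ → EuclideanSpace ℝ (Fin n))
    (η : (ℕ → Fin M) → ℕ → ℝ)
    (C : (ℕ → Fin M) → ℕ → ℝ)
    (Q : ℕ → ℝ) (hQ0 : Q 0 = 0) (hQrec : ∀ k : ℕ, Q (k + 1) = ξ * Q k + 1)
    (w0 : EuclideanSpace ℝ (Fin n)) (hw0 : ∀ ω, w ω 0 = w0)
    (hwrec : ∀ ω k, w ω (k + 1) = w ω k - η ω k • gradient (f (ω k)) (w ω k))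
    -- Zhang–Hager recursion, with `C_{-1} = f_{i_0}(w_0)`
    (hC0 : ∀ ω, C ω 0 =
      max ((ξ * Q 0 * (f (ω 0) (w ω 0)) + f (ω 0) (w ω 0)) / (ξ * Q 0 + 1))
        (f (ω 0) (w ω 0)))
    (hCrec : ∀ ω k, C ω (k + 1) =
      max ((ξ * Q (k + 1) * C ω k + f (ω (k + 1)) (w ω (k + 1))) / (ξ * Q (k + 1) + 1))
        (f (ω (k + 1)) (w ω (k + 1))))
    (hηbounds : ∀ ω k, η ω k ∈ Set.Icc ηmin ηmax)
    (hls : ∀ ω k, f (ω k) (w ω (k + 1)) ≤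
      C ω k - c * η ω k * ‖gradient (f (ω k)) (w ω k)‖ ^ 2)
    -- adaptedness: the step size at iteration `k` depends only on the indices `i_0, …, i_k`
    (hadapted : ∀ ω ω' k, (∀ j ≤ k, ω j = ω' j) → η ω k = η ω' k) :
    ∀ k : ℕ,
      (1 / (M : ℝ) ^ (k + 1)) * ∑ σ : Fin (k + 1) → Fin M,
        (‖w (fun j => if h : j < k + 1 then σ ⟨j, h⟩ else σ ⟨0, Nat.succ_pos k⟩) (k + 1)
            - wstar‖ ^ 2
          + a * (C (fun j => if h : j < k + 1 then σ ⟨j, h⟩ else σ ⟨0, Nat.succ_pos k⟩) k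
            - fstar)) ≤
      d ^ k * (‖w0 - wstar‖ ^ 2 + a * (F w0 - fstar)) := by
  intro k
  have hM' : (0 : ℝ) < M := by exact_mod_cast hM
  have hc0 : 0 < c := by linarith
  have hfstar : ∀ i x, fstar ≤ f i x := fun i x => (hval i).symm.trans_le (hmin i x)
  have hgap : ∀ i x, f i x - fstar ≤ inner ℝ (gradient (f i) x) (x - wstar) := fun i x => by
    simpa [hval] using (hconv i).sub_le_inner_gradient (hdiff i x) wstar
  have hgrad : ∀ i, gradient (f i) wstar = 0 := fun i => by
    have h : IsLocalMin (f i) wstar := Filter.Eventually.of_forall (hmin i)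
    rw [gradient, h.fderiv_eq_zero, map_zero]
  have hsum : ∀ x, M * (μ / 2 * ‖x - wstar‖ ^ 2) ≤
      ∑ i, (inner ℝ (gradient (f i) x) (x - wstar) - (f i x - fstar)) := fun x => by
    simpa only [hval] using card_mul_sq_norm_le_sum_inner_gradient hM hdiff hF hsc x wstar
  have hQ : ∀ k, 0 ≤ Q k ∧ Q k ≤ ξ * Q k + 1 := fun k => by
    induction k with
    | zero => simp [hQ0]
    | succ k ih =>
      rw [hQrec]
      exact ⟨ih.1.trans ih.2, by nlinarith [mul_le_mul_of_nonneg_left ih.2 hξ0]⟩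
  have hC0' : ∀ ω, C ω 0 = f (ω 0) w0 := fun ω => by simp [hC0, hQ0, hw0]
  have hCge : ∀ ω k, fstar ≤ C ω k := fun ω k => by
    cases k with
    | zero => rw [hC0']; exact hfstar _ _
    | succ k => rw [hCrec]; exact (hfstar _ _).trans (le_max_right _ _)
  have hCle : ∀ ω k, C ω (k + 1) - fstar ≤
      ξ * (C ω k - fstar) + (f (ω (k + 1)) (w ω (k + 1)) - fstar) := fun ω k => by
    rw [hCrec]
    exact zhang_hager_step_bounds hξ0 (hQ _).1 (hQ _).2 (hCge ω k) (hfstar _ _)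
  by_cases hL : 0 < Lmax
  swap
  · -- the gradients are constant, so the space is a single point
    have hpt : ∀ x, x = wstar := fun x => by
      have h1 : ∀ i, inner ℝ (gradient (f i) x) (x - wstar) - (f i x - fstar) ≤ 0 := fun i => by
        have h2 := hLip i x wstar
        have h3 : L i ≤ Lmax := hLmax.2 ⟨i, rfl⟩
        have h4 : gradient (f i) x = 0 := by
          rw [hgrad, sub_zero] at h2
          exact norm_le_zero_iff.1 (h2.trans
            (mul_nonpos_of_nonpos_of_nonneg (h3.trans (not_lt.1 hL)) (norm_nonneg _)))
        rw [h4, inner_zero_left]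
        linarith [hfstar i x]
      have h5 := (hsum x).trans (Finset.sum_nonpos fun i _ => h1 i)
      by_contra hne
      have : 0 < ‖x - wstar‖ := norm_pos_iff.2 (sub_ne_zero.2 hne)
      exact absurd h5 (not_le.2 (by positivity))
    have hCeq : ∀ ω k, C ω k - fstar = 0 := fun ω k => by
      refine le_antisymm ?_ (sub_nonneg.2 (hCge ω k))
      induction k with
      | zero => rw [hC0', hpt w0, hval, sub_self]
      | succ k ih =>
        refine (hCle ω k).trans ?_
        rw [hpt (w ω (k + 1)), hval, sub_self, add_zero]
        exact mul_nonpos_of_nonneg_of_nonpos hξ0 ih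
    simp [hCeq, fun ω k => hpt (w ω k), hpt w0, hFval]
  have hηpos : 0 < ηmin := by
    rw [hηmin]
    exact lt_min (div_pos (mul_pos (mul_pos two_pos hδ.1) (sub_pos.2 hc1)) hL) hηbarmin
  have ha0 : 0 < a := by
    rw [ha]
    exact mul_pos hηpos (sub_pos.2 (by rw [div_lt_iff₀ hc0]; linarith))
  have hηmax : 0 < ηmax := hηbarmin.trans_le hηbarmax
  have hb0 : 0 ≤ b := by rw [hb]; positivity
  have hab : (a + ηmax / c) * ξ = a * b := by rw [hb]; field_simp
  have hone : ∀ ω k P, 0 ≤ P → C ω k - fstar ≤ ξ * P + (f (ω k) (w ω k) - fstar) →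
      ‖w ω (k + 1) - wstar‖ ^ 2 + a * (C ω k - fstar) ≤
        ‖w ω k - wstar‖ ^ 2 - 2 * ηmin * (inner ℝ (gradient (f (ω k)) (w ω k)) (w ω k - wstar)
          - (f (ω k) (w ω k) - fstar)) + a * b * P := fun ω k P hP hR => by
    rw [hwrec, ← hab]
    refine sq_norm_gradient_step_le hc hηpos (hηbounds ω k) ha hξ0 hP
      (sub_nonneg.2 (hfstar _ _)) (hgap _ _) hR ?_
    linarith [hls ω k, hfstar (ω k) (w ω (k + 1))]
  have havg : ∀ x P (W : Fin M → ℝ),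
      (∀ i, W i ≤ ‖x - wstar‖ ^ 2 - 2 * ηmin * (inner ℝ (gradient (f i) x) (x - wstar)
        - (f i x - fstar)) + P) →
      ∑ i, W i ≤ M * ((1 - ηmin * μ) * ‖x - wstar‖ ^ 2 + P) := fun x P W hW => by
    refine (Finset.sum_le_sum fun i _ => hW i).trans ?_
    rw [Finset.sum_add_distrib, Finset.sum_sub_distrib, ← Finset.mul_sum]
    simp only [Finset.sum_const, Finset.card_univ, Fintype.card_fin, nsmul_eq_mul]
    nlinarith [mul_le_mul_of_nonneg_left (hsum x) hηpos.le]
  have hwad : ∀ k ω ω', (∀ j < k, ω j = ω' j) → w ω k = w ω' k := fun k => by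
    induction k with
    | zero => intro ω ω' _; rw [hw0, hw0]
    | succ k ih =>
      intro ω ω' h
      rw [hwrec, hwrec, ih ω ω' fun j hj => h j (by omega), h k (by omega),
        hadapted ω ω' k fun j hj => h j (by omega)]
  have hCad : ∀ k ω ω', (∀ j ≤ k, ω j = ω' j) → C ω k = C ω' k := fun k => by
    induction k with
    | zero => intro ω ω' h; rw [hC0', hC0', h 0 le_rfl]
    | succ k ih =>
      intro ω ω' h
      rw [hCrec, hCrec, ih ω ω' fun j hj => h j (by omega), h (k + 1) le_rfl,
        hwad (k + 1) ω ω' fun j hj => h j (by omega)]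
  refine average_extendTuple_le_pow hM
    (V := fun ω k => ‖w ω (k + 1) - wstar‖ ^ 2 + a * (C ω k - fstar))
    (hb0.trans (hd ▸ le_max_right _ _)) ?_ ?_ k
  · rw [← (Equiv.funUnique (Fin 1) (Fin M)).symm.sum_comp]
    refine (havg w0 0 _ fun i => ?_).trans (mul_le_mul_of_nonneg_left ?_ hM'.le)
    · have h := hone (extendTuple 0 ((Equiv.funUnique (Fin 1) (Fin M)).symm i)) 0 0 le_rfl
        (by rw [hC0', hw0]; simp)
      have e : extendTuple 0 ((Equiv.funUnique (Fin 1) (Fin M)).symm i) 0 = i := by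
        simp [extendTuple]
      rw [e, hw0, mul_zero] at h
      exact h
    · have h1 : 0 ≤ ηmin * μ * ‖w0 - wstar‖ ^ 2 := by positivity
      have h2 : 0 ≤ a * (F w0 - fstar) :=
        mul_nonneg ha0.le (sub_nonneg.2 (hFval.symm.trans_le (hFmin w0)))
      linarith
  · intro k τ
    have hCτ := sub_nonneg.2 (hCge (extendTuple k τ) k)
    refine (havg (w (extendTuple k τ) (k + 1)) (a * b * (C (extendTuple k τ) k - fstar)) _
      fun i => ?_).trans (mul_le_mul_of_nonneg_left ?_ hM'.le)
    · have hag : ∀ j ≤ k, extendTuple (k + 1) (Fin.snoc τ i : Fin (k + 2) → Fin M) j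
          = extendTuple k τ j := fun j hj => extendTuple_snoc_of_le τ i hj
      have h := hone (extendTuple (k + 1) (Fin.snoc τ i : Fin (k + 2) → Fin M)) (k + 1)
        (C (extendTuple (k + 1) (Fin.snoc τ i : Fin (k + 2) → Fin M)) k - fstar)
        (sub_nonneg.2 (hCge _ _)) (hCle _ _)
      rw [extendTuple_snoc_last, hCad k _ _ hag,
        hwad (k + 1) _ _ fun j hj => hag j (by omega)] at h
      exact h
    · have h1 : (1 - ηmin * μ) * ‖w (extendTuple k τ) (k + 1) - wstar‖ ^ 2 ≤
          d * ‖w (extendTuple k τ) (k + 1) - wstar‖ ^ 2 :=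
        mul_le_mul_of_nonneg_right (hd ▸ le_max_left _ _) (by positivity)
      have h2 : b * (a * (C (extendTuple k τ) k - fstar)) ≤
          d * (a * (C (extendTuple k τ) k - fstar)) :=
        mul_le_mul_of_nonneg_right (hd ▸ le_max_right _ _) (mul_nonneg ha0.le hCτ)
      linarith
end

section
/- Deterministic one-step bound for the convex rate: let g : ℝⁿ → ℝ be differentiable with global minimizer w* and g(w*) = f*. Let ξ ∈ [0,1), Q ∈ [0, 1/(1−ξ)], C ∈ ℝ with C ≥ f*, c ∈ (1/2,1), 0 < a₁ < 2 − 1/c, η > 0, define C' = max{(ξQ·C + g(w))/(ξQ + 1), g(w)}, and suppose w⁺ = w − η∇g(w) satisfies g(w⁺) ≤ C' − cη‖∇g(w)‖². Then, with b₁ = (1 + 1/(a₁c))·ξ, one has ‖w⁺ − w*‖² + η·a₁·(C' − f*) ≤ ‖w − w*‖² + η·(−2⟨∇g(w), w − w*⟩ + (a₁ + 1/c)(g(w) − f*)) + η·a₁·b₁·(C − f*). -/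
open RealInnerProductSpace

/-- The nonmonotone term exceeds `v` by at most `ξ (C - m)`, for any lower bound `m` of `v` and
`C`. -/
lemma max_nonmonotone_le {ξ Q C v m : ℝ} (hξ0 : 0 ≤ ξ) (hξ1 : ξ < 1) (hQ0 : 0 ≤ Q)
    (hQ1 : Q ≤ 1 / (1 - ξ)) (hC : m ≤ C) (hv : m ≤ v) :
    max ((ξ * Q * C + v) / (ξ * Q + 1)) v ≤ v + ξ * (C - m) := by
  have hCm : 0 ≤ ξ * (C - m) := mul_nonneg hξ0 (sub_nonneg.2 hC)
  have hξQ : 0 ≤ ξ * Q := mul_nonneg hξ0 hQ0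
  have hQ : Q * (1 - ξ) ≤ 1 := (le_div_iff₀ (sub_pos.2 hξ1)).1 hQ1
  refine max_le ?_ (by linarith)
  rw [div_le_iff₀ (by linarith)]
  have hv' := mul_nonneg hξQ (sub_nonneg.2 hv)
  have hC' := mul_nonneg hCm (sub_nonneg.2 hQ)
  linarith

/-- Deterministic one-step bound for the convex rate (per-sample inequality underlying
Theorem 2): with `C' = max {(ξQC + g(w))/(ξQ + 1), g(w)}`, `w⁺ = w - η ∇g(w)` satisfying
the nonmonotone sufficient-decrease condition, and `b₁ = (1 + 1/(a₁ c)) ξ`, one has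
`‖w⁺ - w*‖² + η a₁ (C' - f*) ≤ ‖w - w*‖² + η (-2⟪∇g(w), w - w*⟫ + (a₁ + 1/c)(g(w) - f*))
  + η a₁ b₁ (C - f*)`. -/
theorem one_step_bound_convex {n : ℕ}
    (g : EuclideanSpace ℝ (Fin n) → ℝ) (hg : Differentiable ℝ g)
    (wstar : EuclideanSpace ℝ (Fin n)) (fstar : ℝ)
    (hmin : ∀ x, g wstar ≤ g x) (hval : g wstar = fstar)
    (ξ Q C c a₁ η b₁ : ℝ)
    (hξ0 : 0 ≤ ξ) (hξ1 : ξ < 1) (hQ0 : 0 ≤ Q) (hQ1 : Q ≤ 1 / (1 - ξ))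
    (hCge : fstar ≤ C) (hc : 1 / 2 < c) (hc1 : c < 1)
    (ha₁pos : 0 < a₁) (ha₁ : a₁ < 2 - 1 / c) (hη : 0 < η)
    (w : EuclideanSpace ℝ (Fin n)) (C' : ℝ)
    (hC' : C' = max ((ξ * Q * C + g w) / (ξ * Q + 1)) (g w))
    (hls : g (w - η • gradient g w) ≤ C' - c * η * ‖gradient g w‖ ^ 2)
    (hb₁ : b₁ = (1 + 1 / (a₁ * c)) * ξ) :
    ‖(w - η • gradient g w) - wstar‖ ^ 2 + η * a₁ * (C' - fstar) ≤
      ‖w - wstar‖ ^ 2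
        + η * (-(2 * ⟪gradient g w, w - wstar⟫) + (a₁ + 1 / c) * (g w - fstar))
        + η * a₁ * b₁ * (C - fstar) := by
  have hc0 : 0 < c := by linarith
  have hexp : ‖(w - η • gradient g w) - wstar‖ ^ 2 =
      ‖w - wstar‖ ^ 2 - 2 * η * ⟪gradient g w, w - wstar⟫ + η ^ 2 * ‖gradient g w‖ ^ 2 := by
    rw [sub_right_comm, norm_sub_sq_real, inner_smul_right, real_inner_comm, norm_smul, mul_pow,
      Real.norm_eq_abs, sq_abs]
    ring
  have hstep : η * ‖gradient g w‖ ^ 2 ≤ 1 / c * (C' - fstar) := by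
    rw [one_div_mul_eq_div, le_div_iff₀ hc0]
    linarith [hmin (w - η • gradient g w)]
  have hC'le : C' ≤ g w + ξ * (C - fstar) :=
    hC' ▸ max_nonmonotone_le hξ0 hξ1 hQ0 hQ1 hCge (hval ▸ hmin w)
  have hab : a₁ * b₁ = (a₁ + 1 / c) * ξ := by
    rw [hb₁]
    field_simp
  have hmain : (a₁ + 1 / c) * C' ≤ (a₁ + 1 / c) * (g w + ξ * (C - fstar)) := by gcongr
  rw [hexp, mul_assoc η a₁ b₁, hab]
  linarith [mul_le_mul_of_nonneg_left hstep hη.le, mul_le_mul_of_nonneg_left hmain hη.le]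
end

section
/- Per-iteration averaged gap bound for the convex rate: assume interpolation, f convex, and each f_i differentiable with global minimizer w*. Let ξ ∈ [0,1), Q ∈ [0, 1/(1−ξ)], C ∈ ℝ with C ≥ f*, c ∈ (1/2,1), 0 < a₁ < 2 − 1/c, ξ < a₁/2, and d₁ = c/(c(2 − a₁) − 1) > 0. Fix w ∈ ℝⁿ and for each i ∈ {1,…,M} let C^{(i)} = max{(ξQ·C + f_i(w))/(ξQ + 1), f_i(w)}, let η^{(i)} > 0 satisfy f_i(w − η^{(i)}∇f_i(w)) ≤ C^{(i)} − c·η^{(i)}·‖∇f_i(w)‖², and set w^{(i)} = w − η^{(i)}∇f_i(w). Then f(w) − f* ≤ (1/M)∑_{i=1}^M (d₁/η^{(i)})·(‖w − w*‖² − ‖w^{(i)} − w*‖²) + d₁·a₁·( (C − f*) − (1/M)∑_{i=1}^M (C^{(i)} − f*) ). -/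
/-- First-order condition: a convex function lies above its tangent hyperplanes. -/
theorem ConvexOn.sub_le_fderiv_sub {E : Type*} [NormedAddCommGroup E] [NormedSpace ℝ E]
    {F : E → ℝ} {F' : E →L[ℝ] ℝ} {x : E} (hF : ConvexOn ℝ Set.univ F)
    (hx : HasFDerivAt F F' x) (y : E) : F x - F y ≤ F' (x - y) := by
  have hconv : ConvexOn ℝ Set.univ (F ∘ AffineMap.lineMap (k := ℝ) x y) := by
    simpa using hF.comp_affineMap (AffineMap.lineMap (k := ℝ) x y)
  have hderiv : HasDerivAt (F ∘ AffineMap.lineMap (k := ℝ) x y) (F' (y - x)) 0 :=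
    HasFDerivAt.comp_hasDerivAt (0 : ℝ) (by simpa using hx) AffineMap.hasDerivAt_lineMap
  have h := hconv.le_slope_of_hasDerivAt (Set.mem_univ 0) (Set.mem_univ 1) one_pos hderiv
  simp only [slope_def_field, Function.comp_apply, AffineMap.lineMap_apply_zero,
    AffineMap.lineMap_apply_one, sub_zero, div_one] at h
  rw [← neg_sub y x, map_neg]
  linarith

/-- The excess of the Zhang–Hager reference value over the current value is controlled by the
previous reference value. -/
theorem nonmonotone_reference_le {ξ Q C c a₁ φ φstar : ℝ}
    (hξ0 : 0 ≤ ξ) (hξ1 : ξ < 1) (hQ0 : 0 ≤ Q) (hQ1 : Q ≤ 1 / (1 - ξ)) (hC : φstar ≤ C)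
    (hφ : φstar ≤ φ) (hc : 0 < c) (ha₁pos : 0 < a₁) (ha₁ : a₁ < 2 - 1 / c)
    (hξa₁ : ξ < a₁ / 2) :
    (1 / c + a₁) * (max ((ξ * Q * C + φ) / (ξ * Q + 1)) φ - φstar) ≤
      (1 / c + a₁) * (φ - φstar) + a₁ * (C - φstar) := by
  have hcinv : 0 < 1 / c := by positivity
  have hq : 0 ≤ ξ * Q := mul_nonneg hξ0 hQ0
  have hqc : ξ * Q * (1 / c) ≤ a₁ := by
    have hQ : Q * (1 - ξ) ≤ 1 := (le_div_iff₀ (by linarith)).mp hQ1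
    have hle : 1 / c ≤ 2 * (1 - ξ) := by linarith
    nlinarith [mul_le_mul_of_nonneg_left hle hq, mul_le_mul_of_nonneg_left hQ hξ0]
  rcases max_cases ((ξ * Q * C + φ) / (ξ * Q + 1)) φ with ⟨h, -⟩ | ⟨h, -⟩ <;> rw [h]
  · have hsplit : (ξ * Q * C + φ) / (ξ * Q + 1) - φstar =
        (φ - φstar) + ξ * Q / (ξ * Q + 1) * (C - φ) := by
      field_simp
      ring
    have hcoef : (1 / c + a₁) * (ξ * Q / (ξ * Q + 1)) ≤ a₁ := by
      rw [← mul_div_assoc, div_le_iff₀ (by linarith)]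
      linarith
    have hnn : 0 ≤ (1 / c + a₁) * (ξ * Q / (ξ * Q + 1)) := by positivity
    rw [hsplit]
    nlinarith [mul_le_mul_of_nonneg_right hcoef (sub_nonneg.2 hC), mul_nonneg hnn (sub_nonneg.2 hφ)]
  · nlinarith [mul_nonneg ha₁pos.le (sub_nonneg.2 hC)]

/-- Distance decrease of one gradient step satisfying a sufficient decrease condition with
reference value `R`. -/
theorem two_inner_sub_le_of_sufficient_decrease {E : Type*} [NormedAddCommGroup E]
    [InnerProductSpace ℝ E] {φ : E → ℝ} {φstar R c η : ℝ} {w wstar g : E}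
    (hφ : ∀ x, φstar ≤ φ x) (hc : 0 < c) (hη : 0 < η)
    (hls : φ (w - η • g) ≤ R - c * η * ‖g‖ ^ 2) :
    2 * inner ℝ g (w - wstar) - 1 / c * (R - φstar) ≤
      1 / η * (‖w - wstar‖ ^ 2 - ‖(w - η • g) - wstar‖ ^ 2) := by
  have hstep : 1 / η * (‖w - wstar‖ ^ 2 - ‖(w - η • g) - wstar‖ ^ 2) =
      2 * inner ℝ g (w - wstar) - η * ‖g‖ ^ 2 := by
    rw [sub_right_comm w, norm_sub_sq_real (w - wstar), inner_smul_right, norm_smul,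
      Real.norm_of_nonneg hη.le, real_inner_comm]
    field_simp
    ring
  have hnorm : η * ‖g‖ ^ 2 ≤ 1 / c * (R - φstar) := by
    rw [one_div_mul_eq_div, le_div_iff₀ hc]
    linarith [hφ (w - η • g)]
  linarith


/-- Per-iteration averaged gap bound for the convex rate: averaging the one-step
Zhang–Hager nonmonotone line-search step over a uniformly sampled index `i`,
`f(w) - f* ≤ (1/M) ∑ i, (d₁/η⁽ⁱ⁾)(‖w - w*‖² - ‖w⁽ⁱ⁾ - w*‖²)
  + d₁ a₁ ((C - f*) - (1/M) ∑ i, (C⁽ⁱ⁾ - f*))`. -/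
theorem averaged_gap_bound_convex {n M : ℕ} (hM : 0 < M)
    (f : Fin M → EuclideanSpace ℝ (Fin n) → ℝ)
    (hdiff : ∀ i, Differentiable ℝ (f i))
    (F : EuclideanSpace ℝ (Fin n) → ℝ)
    (hF : ∀ x, F x = (1 / (M : ℝ)) * ∑ i, f i x)
    (hFconv : ConvexOn ℝ Set.univ F)
    (wstar : EuclideanSpace ℝ (Fin n)) (fstar : ℝ)
    -- interpolation: `w*` minimizes `F` and every `f_i`, with common optimal value `fstar`
    (hmin : ∀ i x, f i wstar ≤ f i x) (hFmin : ∀ x, F wstar ≤ F x)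
    (hval : ∀ i, f i wstar = fstar) (hFval : F wstar = fstar)
    (ξ Q C c a₁ d₁ : ℝ)
    (hξ0 : 0 ≤ ξ) (hξ1 : ξ < 1) (hQ0 : 0 ≤ Q) (hQ1 : Q ≤ 1 / (1 - ξ))
    (hCge : fstar ≤ C) (hc : 1 / 2 < c) (hc1 : c < 1)
    (ha₁pos : 0 < a₁) (ha₁ : a₁ < 2 - 1 / c) (hξa₁ : ξ < a₁ / 2)
    (hd₁ : d₁ = c / (c * (2 - a₁) - 1))
    (w : EuclideanSpace ℝ (Fin n)) (Ci η' : Fin M → ℝ)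
    (hCi : ∀ i, Ci i = max ((ξ * Q * C + f i w) / (ξ * Q + 1)) (f i w))
    (hη' : ∀ i, 0 < η' i)
    (hls : ∀ i, f i (w - η' i • gradient (f i) w) ≤
      Ci i - c * η' i * ‖gradient (f i) w‖ ^ 2) :
    F w - fstar ≤
      (1 / (M : ℝ)) * ∑ i,
          (d₁ / η' i) * (‖w - wstar‖ ^ 2 - ‖(w - η' i • gradient (f i) w) - wstar‖ ^ 2)
        + d₁ * a₁ * ((C - fstar) - (1 / (M : ℝ)) * ∑ i, (Ci i - fstar)) := by
  have hc0 : 0 < c := by linarith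
  have hgap : 0 < 2 - a₁ - 1 / c := by linarith
  have hd : d₁ = 1 / (2 - a₁ - 1 / c) := by
    rw [hd₁, show c * (2 - a₁) - 1 = c * (2 - a₁ - 1 / c) by field_simp,
      div_mul_cancel_left₀ hc0.ne', one_div (2 - a₁ - 1 / c)]
  have hd0 : 0 < d₁ := by rw [hd]; positivity
  have hd1 : d₁ * (1 / c + a₁) = 2 * d₁ - 1 := by
    have : d₁ * (2 - a₁ - 1 / c) = 1 := by rw [hd]; exact one_div_mul_cancel hgap.ne'
    linarith
  have hstar : ∀ i x, fstar ≤ f i x := fun i x => hval i ▸ hmin i x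
  have hM' : (M : ℝ) ≠ 0 := by positivity
  have hgrad : F w - fstar ≤
      1 / (M : ℝ) * ∑ i, inner ℝ (gradient (f i) w) (w - wstar) := by
    have hder : HasFDerivAt F ((1 / (M : ℝ)) • ∑ i, fderiv ℝ (f i) w) w := by
      rw [funext hF]
      exact (HasFDerivAt.fun_sum fun i _ => (hdiff i w).hasFDerivAt).const_mul _
    simpa [gradient, hFval] using hFconv.sub_le_fderiv_sub hder wstar
  have hterm : ∀ i, (f i w - fstar) +
      2 * d₁ * (inner ℝ (gradient (f i) w) (w - wstar) - (f i w - fstar)) ≤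
      d₁ / η' i * (‖w - wstar‖ ^ 2 - ‖(w - η' i • gradient (f i) w) - wstar‖ ^ 2)
        + d₁ * a₁ * ((C - fstar) - (Ci i - fstar)) := by
    intro i
    have href := nonmonotone_reference_le hξ0 hξ1 hQ0 hQ1 hCge (hstar i w) hc0 ha₁pos ha₁ hξa₁
    rw [← hCi i] at href
    have hdec := two_inner_sub_le_of_sufficient_decrease (wstar := wstar) (hstar i) hc0 (hη' i)
      (hls i)
    have hcoef : d₁ * (1 / c + a₁) * (f i w - fstar) = (2 * d₁ - 1) * (f i w - fstar) := by
      rw [hd1]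
    rw [div_eq_mul_one_div d₁, mul_assoc d₁ (1 / η' i)]
    linarith [mul_le_mul_of_nonneg_left href hd0.le, mul_le_mul_of_nonneg_left hdec hd0.le]
  have hsum := mul_le_mul_of_nonneg_left
    (Finset.sum_le_sum fun i (_ : i ∈ Finset.univ) => hterm i) (one_div_nonneg.2 M.cast_nonneg)
  have hconst : ∀ r : ℝ, 1 / (M : ℝ) * (M * r) = r := fun r => by field_simp
  have hFgap : 1 / (M : ℝ) * ∑ i, (f i w - fstar) = F w - fstar := by
    simp only [Finset.sum_sub_distrib, Finset.sum_const, Finset.card_univ, Fintype.card_fin,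
      nsmul_eq_mul, mul_sub, hconst, hF w]
  have hCgap : 1 / (M : ℝ) * ∑ i, ((C - fstar) - (Ci i - fstar)) =
      (C - fstar) - 1 / (M : ℝ) * ∑ i, (Ci i - fstar) := by
    rw [Finset.sum_sub_distrib, mul_sub, Finset.sum_const, Finset.card_univ, Fintype.card_fin,
      nsmul_eq_mul, hconst]
  simp only [Finset.sum_add_distrib, ← Finset.mul_sum] at hsum
  rw [mul_add, mul_add, mul_left_comm _ (2 * d₁), mul_left_comm _ (d₁ * a₁), hCgap, hFgap,
    Finset.sum_sub_distrib, mul_sub (1 / (M : ℝ)), hFgap] at hsum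
  linarith [mul_nonneg (mul_nonneg zero_le_two hd0.le) (sub_nonneg.2 hgrad)]
end

section
/- Deterministic one-step bound for the PL rate: let f : ℝⁿ → ℝ be differentiable with L_max-Lipschitz gradient and let g : ℝⁿ → ℝ be differentiable with global minimizer w* and g(w*) = f*. Let ξ ∈ [0,1), Q ∈ [0, 1/(1−ξ)], C ∈ ℝ with C ≥ f*, c ∈ (0,1), a₂ > 0, η > 0, define C' = max{(ξQ·C + g(w))/(ξQ + 1), g(w)}, and suppose w⁺ = w − η∇g(w) satisfies g(w⁺) ≤ C' − cη‖∇g(w)‖². Then, with b₂ = (1 + L_max/(a₂c))·ξ, one has (f(w⁺) − f(w))/η + a₂(C' − f*) ≤ −⟨∇f(w), ∇g(w)⟩ + (L_max/(2c) + a₂)·(g(w) − f*) + a₂·b₂·(C − f*). -/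
open RealInnerProductSpace

/-- The descent lemma for a differentiable function with `L`-Lipschitz gradient. -/
theorem le_add_inner_gradient_add_sq_of_lipschitz_gradient {E : Type*} [NormedAddCommGroup E]
    [InnerProductSpace ℝ E] [CompleteSpace E] {F : E → ℝ} (hF : Differentiable ℝ F) {L : ℝ}
    (hLip : ∀ x y, ‖gradient F x - gradient F y‖ ≤ L * ‖x - y‖) (x v : E) :
    F (x + v) ≤ F x + ⟪gradient F x, v⟫ + L / 2 * ‖v‖ ^ 2 := by
  have hderiv (t : ℝ) :
      HasDerivAt (fun s : ℝ => F (x + s • v) - s * ⟪gradient F x, v⟫ - s ^ 2 * (L / 2 * ‖v‖ ^ 2))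
        (⟪gradient F (x + t • v), v⟫ - ⟪gradient F x, v⟫ - t * (L * ‖v‖ ^ 2)) t := by
    have hline : HasDerivAt (fun s : ℝ => x + s • v) v t := by
      simpa using ((hasDerivAt_id t).smul_const v).const_add x
    have hcomp := (hF (x + t • v)).hasGradientAt.hasFDerivAt.comp_hasDerivAt t hline
    rw [InnerProductSpace.toDual_apply_apply] at hcomp
    refine ((hcomp.sub ((hasDerivAt_id t).mul_const ⟪gradient F x, v⟫)).sub
      ((hasDerivAt_pow 2 t).mul_const (L / 2 * ‖v‖ ^ 2))).congr_deriv ?_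
    push_cast
    ring
  have hanti : AntitoneOn
      (fun s : ℝ => F (x + s • v) - s * ⟪gradient F x, v⟫ - s ^ 2 * (L / 2 * ‖v‖ ^ 2))
      (Set.Icc 0 1) := by
    refine antitoneOn_of_hasDerivWithinAt_nonpos (convex_Icc 0 1)
      (fun t _ => (hderiv t).continuousAt.continuousWithinAt)
      (fun t _ => (hderiv t).hasDerivWithinAt) fun t ht => ?_
    rw [interior_Icc] at ht
    have hgrad : ‖gradient F (x + t • v) - gradient F x‖ ≤ L * (t * ‖v‖) := by
      simpa [norm_smul, abs_of_pos ht.1] using hLip (x + t • v) x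
    have hinner := real_inner_le_norm (gradient F (x + t • v) - gradient F x) v
    rw [inner_sub_left] at hinner
    linarith [mul_le_mul_of_nonneg_right hgrad (norm_nonneg v)]
  have h := hanti (Set.left_mem_Icc.2 zero_le_one) (Set.right_mem_Icc.2 zero_le_one) zero_le_one
  simp only [one_smul, zero_smul, add_zero] at h
  linarith

/-- The excess of the Zhang–Hager nonmonotone term over a lower bound `m`. -/
theorem max_zhangHager_sub_le {ξ Q C y m : ℝ} (hξ0 : 0 ≤ ξ) (hξ1 : ξ < 1) (hQ0 : 0 ≤ Q)
    (hQ1 : Q ≤ 1 / (1 - ξ)) (hC : m ≤ C) (hy : m ≤ y) :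
    max ((ξ * Q * C + y) / (ξ * Q + 1)) y - m ≤ (y - m) + ξ * (C - m) := by
  have hξQ : 0 ≤ ξ * Q := mul_nonneg hξ0 hQ0
  rw [le_div_iff₀ (sub_pos.2 hξ1)] at hQ1
  rw [sub_le_iff_le_add, max_le_iff]
  constructor
  · rw [div_le_iff₀ (by positivity)]
    have h₁ := mul_nonneg (mul_nonneg hξ0 (sub_nonneg.2 hQ1)) (sub_nonneg.2 hC)
    have h₂ := mul_nonneg hξQ (sub_nonneg.2 hy)
    linarith
  · linarith [mul_nonneg hξ0 (sub_nonneg.2 hC)]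

/-- Deterministic one-step bound for the PL rate (per-sample inequality underlying
Theorem 3): `F` is the full objective with `L_max`-Lipschitz gradient, `g` plays the
role of the sampled mini-batch function, `C' = max {(ξQC + g(w))/(ξQ + 1), g(w)}`, and
`w⁺ = w - η ∇g(w)` satisfies the nonmonotone sufficient-decrease condition.  With
`b₂ = (1 + L_max/(a₂ c)) ξ`, one has
`(F(w⁺) - F(w))/η + a₂ (C' - f*) ≤ -⟪∇F(w), ∇g(w)⟫ + (L_max/(2c) + a₂)(g(w) - f*)
  + a₂ b₂ (C - f*)`. -/
theorem one_step_bound_pl {n : ℕ}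
    (F g : EuclideanSpace ℝ (Fin n) → ℝ)
    (hFdiff : Differentiable ℝ F) (hg : Differentiable ℝ g)
    (Lmax : ℝ) (hLmaxpos : 0 ≤ Lmax)
    (hLip : ∀ x y, ‖gradient F x - gradient F y‖ ≤ Lmax * ‖x - y‖)
    (wstar : EuclideanSpace ℝ (Fin n)) (fstar : ℝ)
    (hmin : ∀ x, g wstar ≤ g x) (hval : g wstar = fstar)
    (ξ Q C c a₂ η b₂ : ℝ)
    (hξ0 : 0 ≤ ξ) (hξ1 : ξ < 1) (hQ0 : 0 ≤ Q) (hQ1 : Q ≤ 1 / (1 - ξ))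
    (hCge : fstar ≤ C) (hc : c ∈ Set.Ioo (0 : ℝ) 1)
    (ha₂ : 0 < a₂) (hη : 0 < η)
    (w : EuclideanSpace ℝ (Fin n)) (C' : ℝ)
    (hC' : C' = max ((ξ * Q * C + g w) / (ξ * Q + 1)) (g w))
    (hls : g (w - η • gradient g w) ≤ C' - c * η * ‖gradient g w‖ ^ 2)
    (hb₂ : b₂ = (1 + Lmax / (a₂ * c)) * ξ) :
    (F (w - η • gradient g w) - F w) / η + a₂ * (C' - fstar) ≤
      -⟪gradient F w, gradient g w⟫ + (Lmax / (2 * c) + a₂) * (g w - fstar)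
        + a₂ * b₂ * (C - fstar) := by
  obtain ⟨hc0, -⟩ := hc
  have hmin' (x) : fstar ≤ g x := hval ▸ hmin x
  have hC'le : C' - fstar ≤ (g w - fstar) + ξ * (C - fstar) :=
    hC' ▸ max_zhangHager_sub_le hξ0 hξ1 hQ0 hQ1 hCge (hmin' w)
  have hstep : η * ‖gradient g w‖ ^ 2 ≤ (C' - fstar) / c := by
    rw [le_div_iff₀ hc0]
    linarith [hmin' (w - η • gradient g w)]
  have hdescent : (F (w - η • gradient g w) - F w) / η ≤
      -⟪gradient F w, gradient g w⟫ + Lmax / 2 * (η * ‖gradient g w‖ ^ 2) := by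
    have h := le_add_inner_gradient_add_sq_of_lipschitz_gradient hFdiff hLip w
      (-(η • gradient g w))
    rw [← sub_eq_add_neg, inner_neg_right, inner_smul_right, norm_neg, norm_smul, mul_pow,
      Real.norm_eq_abs, sq_abs] at h
    rw [div_le_iff₀ hη]
    linarith
  have hK : 0 ≤ Lmax / (2 * c) + a₂ := by positivity
  have hslack : 0 ≤ Lmax / (2 * c) * (ξ * (C - fstar)) :=
    mul_nonneg (by positivity) (mul_nonneg hξ0 (sub_nonneg.2 hCge))
  calc (F (w - η • gradient g w) - F w) / η + a₂ * (C' - fstar)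
      ≤ -⟪gradient F w, gradient g w⟫ + Lmax / 2 * ((C' - fstar) / c) + a₂ * (C' - fstar) := by
        linarith [mul_le_mul_of_nonneg_left hstep (div_nonneg hLmaxpos zero_le_two)]
    _ = -⟪gradient F w, gradient g w⟫ + (Lmax / (2 * c) + a₂) * (C' - fstar) := by
        ring
    _ ≤ -⟪gradient F w, gradient g w⟫
          + (Lmax / (2 * c) + a₂) * ((g w - fstar) + ξ * (C - fstar)) := by
        gcongr
    _ ≤ -⟪gradient F w, gradient g w⟫
          + (Lmax / (2 * c) + a₂) * ((g w - fstar) + ξ * (C - fstar))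
          + Lmax / (2 * c) * (ξ * (C - fstar)) := le_add_of_nonneg_right hslack
    _ = -⟪gradient F w, gradient g w⟫ + (Lmax / (2 * c) + a₂) * (g w - fstar)
          + a₂ * b₂ * (C - fstar) := by
        rw [hb₂]
        field_simp
        ring
end

section
/- Per-iteration averaged contraction for the PL rate: assume interpolation, that f has L_max-Lipschitz gradient, and that f satisfies the PL condition with constant μ > 0, i.e. ‖∇f(w)‖² ≥ 2μ(f(w) − f*) for all w. Let ξ ∈ [0,1), Q ∈ [0, 1/(1−ξ)], C ∈ ℝ with C ≥ f*, c ∈ (0,1), a₂ > 0, 0 < η_min ≤ η_max, and set ν = η_max·(1/η_min + L_max/(2c) + a₂ − 2μ) and b₂ = (1 + L_max/(a₂c))·ξ; assume ν ≥ 0. Fix w ∈ ℝⁿ and for each i ∈ {1,…,M} let C^{(i)} = max{(ξQ·C + f_i(w))/(ξQ + 1), f_i(w)}, let η^{(i)} ∈ [η_min, η_max] satisfy f_i(w − η^{(i)}∇f_i(w)) ≤ C^{(i)} − c·η^{(i)}·‖∇f_i(w)‖², and set w^{(i)} = w − η^{(i)}∇f_i(w). Then (1/M)∑_{i=1}^M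 [ f(w^{(i)}) − f* + a₂η_max(C^{(i)} − f*) ] ≤ max{ν, b₂}·( f(w) − f* + a₂η_max(C − f*) ). -/
/-- The descent lemma for a differentiable function with Lipschitz gradient. -/
theorem le_add_inner_gradient_add_sq {E : Type*} [NormedAddCommGroup E] [InnerProductSpace ℝ E]
    [CompleteSpace E] {F : E → ℝ} (hF : Differentiable ℝ F) {L : ℝ}
    (hLip : ∀ x y, ‖gradient F x - gradient F y‖ ≤ L * ‖x - y‖) (x d : E) :
    F (x + d) ≤ F x + inner ℝ (gradient F x) d + L / 2 * ‖d‖ ^ 2 := by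
  have hderiv (t : ℝ) : HasDerivAt
      (fun t : ℝ => F (x + t • d) - t * inner ℝ (gradient F x) d - L / 2 * ‖d‖ ^ 2 * t ^ 2)
      (inner ℝ (gradient F (x + t • d) - gradient F x) d - L * ‖d‖ ^ 2 * t) t := by
    have hline : HasDerivAt (fun t : ℝ => x + t • d) d t := by
      simpa using ((hasDerivAt_id t).smul_const d).const_add x
    have hcomp := (hF (x + t • d)).hasGradientAt.hasFDerivAt.comp_hasDerivAt t hline
    rw [InnerProductSpace.toDual_apply_apply] at hcomp
    refine ((hcomp.sub ((hasDerivAt_id t).mul_const (inner ℝ (gradient F x) d))).sub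
      ((hasDerivAt_pow 2 t).const_mul (L / 2 * ‖d‖ ^ 2))).congr_deriv ?_
    rw [inner_sub_left]
    push_cast
    ring
  have hanti := antitoneOn_of_deriv_nonpos (convex_Icc (0 : ℝ) 1)
    (fun t _ => (hderiv t).continuousAt.continuousWithinAt)
    (fun t _ => (hderiv t).differentiableAt.differentiableWithinAt) (fun t ht => by
      rw [interior_Icc] at ht
      rw [(hderiv t).deriv, sub_nonpos]
      calc inner ℝ (gradient F (x + t • d) - gradient F x) d
          ≤ ‖gradient F (x + t • d) - gradient F x‖ * ‖d‖ := real_inner_le_norm _ _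
        _ ≤ L * ‖x + t • d - x‖ * ‖d‖ := by gcongr; exact hLip _ _
        _ = L * ‖d‖ ^ 2 * t := by
          rw [add_sub_cancel_left, norm_smul, Real.norm_of_nonneg ht.1.le]; ring)
  have := hanti (Set.left_mem_Icc.2 zero_le_one) (Set.right_mem_Icc.2 zero_le_one) zero_le_one
  simp only [one_smul, zero_smul, add_zero] at this
  linarith

/-- The Zhang–Hager reference value exceeds the current value by at most `ξ` times the gap of the
previous reference value. -/
theorem zhangHager_max_sub_le {ξ Q C m v : ℝ} (hξ0 : 0 ≤ ξ) (hξ1 : ξ < 1) (hQ0 : 0 ≤ Q)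
    (hQ1 : Q ≤ 1 / (1 - ξ)) (hC : m ≤ C) (hv : m ≤ v) :
    max ((ξ * Q * C + v) / (ξ * Q + 1)) v - m ≤ (v - m) + ξ * (C - m) := by
  have hξQ : 0 ≤ ξ * Q := mul_nonneg hξ0 hQ0
  have hQ : ξ * Q ≤ ξ * (ξ * Q + 1) := by
    rw [le_div_iff₀ (by linarith)] at hQ1
    nlinarith
  have hgap : 0 ≤ ξ * (C - m) := mul_nonneg hξ0 (by linarith)
  rw [sub_le_iff_le_add, max_le_iff]
  refine ⟨?_, by linarith⟩
  rw [div_le_iff₀ (by linarith)]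
  nlinarith [mul_le_mul_of_nonneg_right hQ (sub_nonneg.2 hC), mul_nonneg hξQ (sub_nonneg.2 hv)]


/-- Per-iteration averaged contraction for the PL rate: averaging the one-step
Zhang–Hager nonmonotone line-search step over a uniformly sampled index `i`,
`(1/M) ∑ i, (f(w⁽ⁱ⁾) - f* + a₂ ηmax (C⁽ⁱ⁾ - f*))
  ≤ max {ν, b₂} (f(w) - f* + a₂ ηmax (C - f*))`,
where `ν = ηmax (1/ηmin + L_max/(2c) + a₂ - 2μ)` and `b₂ = (1 + L_max/(a₂ c)) ξ`. -/
theorem averaged_contraction_pl {n M : ℕ} (hM : 0 < M)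
    (f : Fin M → EuclideanSpace ℝ (Fin n) → ℝ)
    (hdiff : ∀ i, Differentiable ℝ (f i))
    (F : EuclideanSpace ℝ (Fin n) → ℝ)
    (hF : ∀ x, F x = (1 / (M : ℝ)) * ∑ i, f i x)
    (Lmax : ℝ) (hLmaxpos : 0 ≤ Lmax)
    (hLip : ∀ x y, ‖gradient F x - gradient F y‖ ≤ Lmax * ‖x - y‖)
    (wstar : EuclideanSpace ℝ (Fin n)) (fstar : ℝ)
    -- interpolation: `w*` minimizes `F` and every `f_i`, with common optimal value `fstar`
    (hmin : ∀ i x, f i wstar ≤ f i x) (hFmin : ∀ x, F wstar ≤ F x)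
    (hval : ∀ i, f i wstar = fstar) (hFval : F wstar = fstar)
    -- PL condition on `F` with constant `μ > 0`
    (μ : ℝ) (hμ : 0 < μ)
    (hPL : ∀ x, 2 * μ * (F x - fstar) ≤ ‖gradient F x‖ ^ 2)
    (ξ Q C c a₂ ηmin ηmax ν b₂ : ℝ)
    (hξ0 : 0 ≤ ξ) (hξ1 : ξ < 1) (hQ0 : 0 ≤ Q) (hQ1 : Q ≤ 1 / (1 - ξ))
    (hCge : fstar ≤ C) (hc : c ∈ Set.Ioo (0 : ℝ) 1) (ha₂ : 0 < a₂)
    (hηmin : 0 < ηmin) (hηminmax : ηmin ≤ ηmax)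
    (hν : ν = ηmax * (1 / ηmin + Lmax / (2 * c) + a₂ - 2 * μ)) (hνnonneg : 0 ≤ ν)
    (hb₂ : b₂ = (1 + Lmax / (a₂ * c)) * ξ)
    (w : EuclideanSpace ℝ (Fin n)) (Ci η' : Fin M → ℝ)
    (hCi : ∀ i, Ci i = max ((ξ * Q * C + f i w) / (ξ * Q + 1)) (f i w))
    (hη' : ∀ i, η' i ∈ Set.Icc ηmin ηmax)
    (hls : ∀ i, f i (w - η' i • gradient (f i) w) ≤
      Ci i - c * η' i * ‖gradient (f i) w‖ ^ 2) :
    (1 / (M : ℝ)) * ∑ i,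
        (F (w - η' i • gradient (f i) w) - fstar + a₂ * ηmax * (Ci i - fstar)) ≤
      max ν b₂ * (F w - fstar + a₂ * ηmax * (C - fstar)) := by
  have hMpos : (0 : ℝ) < M := Nat.cast_pos.2 hM
  obtain ⟨hc0, -⟩ := hc
  have hηmax : 0 < ηmax := hηmin.trans_le hηminmax
  have hFeq : F = fun x => (1 / (M : ℝ)) * ∑ i, f i x := funext hF
  have hFdiff : Differentiable ℝ F := by
    rw [hFeq]
    exact (Differentiable.fun_sum fun i _ => hdiff i).const_mul _
  have hgrad : ∀ d, inner ℝ (gradient F w) d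
      = (1 / (M : ℝ)) * ∑ i, inner ℝ (gradient (f i) w) d := by
    intro d
    have hfderiv := (HasFDerivAt.fun_sum (u := Finset.univ) fun i _ =>
      (hdiff i w).hasGradientAt.hasFDerivAt).const_mul (1 / (M : ℝ))
    rw [← hFeq] at hfderiv
    simpa using DFunLike.congr_fun ((hFdiff w).hasGradientAt.hasFDerivAt.unique hfderiv) d
  have hfstar (i : Fin M) (x) : fstar ≤ f i x := hval i ▸ hmin i x
  have hFstar (x) : fstar ≤ F x := hFval ▸ hFmin x
  have hCi_le (i : Fin M) : Ci i - fstar ≤ (f i w - fstar) + ξ * (C - fstar) := by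
    rw [hCi i]
    exact zhangHager_max_sub_le hξ0 hξ1 hQ0 hQ1 hCge (hfstar i w)
  set A := Lmax / (2 * c) with hA
  have hA0 : 0 ≤ A := by positivity
  have hstep (i : Fin M) : F (w - η' i • gradient (f i) w) - fstar + a₂ * ηmax * (Ci i - fstar) ≤
      ηmax * (1 / ηmin * (F w - fstar) - inner ℝ (gradient (f i) w) (gradient F w)
        + (A + a₂) * (f i w - fstar + ξ * (C - fstar))) := by
    obtain ⟨hηl, hηu⟩ := hη' i
    have hη : 0 < η' i := hηmin.trans_le hηl
    have hdescent := le_add_inner_gradient_add_sq hFdiff hLip w (-(η' i • gradient (f i) w))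
    rw [← sub_eq_add_neg, inner_neg_right, norm_neg, real_inner_smul_right, norm_smul,
      Real.norm_of_nonneg hη.le, real_inner_comm] at hdescent
    set y := w - η' i • gradient (f i) w
    set p := inner ℝ (gradient (f i) w) (gradient F w)
    have hsq : Lmax / 2 * (η' i * ‖gradient (f i) w‖ ^ 2) ≤ A * (Ci i - fstar) := by
      have := mul_le_mul_of_nonneg_left
        (show c * η' i * ‖gradient (f i) w‖ ^ 2 ≤ Ci i - fstar by
          linarith [hls i, hfstar i y]) hA0
      refine le_trans (le_of_eq ?_) this
      rw [hA]
      field_simp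
    have hdiv : (F y - fstar) / η' i ≤ (F w - fstar) / η' i - p + A * (Ci i - fstar) := by
      rw [div_le_iff₀ hη]
      have : (F w - fstar) / η' i * η' i = F w - fstar := div_mul_cancel₀ _ hη.ne'
      nlinarith [mul_le_mul_of_nonneg_right hsq hη.le]
    have hlow : (F y - fstar) / ηmax ≤ (F y - fstar) / η' i :=
      div_le_div_of_nonneg_left (sub_nonneg.2 (hFstar y)) hη hηu
    have hup : (F w - fstar) / η' i ≤ 1 / ηmin * (F w - fstar) := by
      rw [one_div_mul_eq_div]
      exact div_le_div_of_nonneg_left (sub_nonneg.2 (hFstar w)) hηmin hηl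
    have hbound := mul_le_mul_of_nonneg_left (hCi_le i) (show 0 ≤ A + a₂ by linarith)
    have hscaled : (F y - fstar) / ηmax + a₂ * (Ci i - fstar) ≤ 1 / ηmin * (F w - fstar) - p
        + (A + a₂) * (f i w - fstar + ξ * (C - fstar)) := by linarith
    calc F y - fstar + a₂ * ηmax * (Ci i - fstar)
        = ηmax * ((F y - fstar) / ηmax + a₂ * (Ci i - fstar)) := by field_simp
      _ ≤ _ := by gcongr
  have hGap : 0 ≤ a₂ * ηmax * (C - fstar) :=
    mul_nonneg (by positivity) (sub_nonneg.2 hCge)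
  have hb₂_le : ηmax * (A + a₂) * ξ * (C - fstar) ≤ b₂ * (a₂ * ηmax * (C - fstar)) := by
    have hcoef : (1 + A / a₂) * ξ ≤ b₂ := by
      have : Lmax / (2 * c * a₂) ≤ Lmax / (a₂ * c) :=
        div_le_div_of_nonneg_left hLmaxpos (by positivity) (by nlinarith [mul_pos ha₂ hc0])
      rw [hb₂, hA, div_div]
      gcongr
    refine le_trans (le_of_eq ?_) (mul_le_mul_of_nonneg_right hcoef hGap)
    field_simp
    ring
  calc (1 / (M : ℝ)) * ∑ i,
        (F (w - η' i • gradient (f i) w) - fstar + a₂ * ηmax * (Ci i - fstar))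
      ≤ (1 / (M : ℝ)) * ∑ i, ηmax * (1 / ηmin * (F w - fstar)
        - inner ℝ (gradient (f i) w) (gradient F w)
        + (A + a₂) * (f i w - fstar + ξ * (C - fstar))) := by
        gcongr with i
        exact hstep i
    _ = ηmax * (1 / ηmin * (F w - fstar) - ‖gradient F w‖ ^ 2
        + (A + a₂) * (F w - fstar + ξ * (C - fstar))) := by
        rw [← real_inner_self_eq_norm_sq, hgrad, hF w]
        simp only [← Finset.mul_sum, Finset.sum_add_distrib, Finset.sum_sub_distrib,
          Finset.sum_const, Finset.card_univ, Fintype.card_fin, nsmul_eq_mul]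
        field_simp
    _ ≤ ν * (F w - fstar) + ηmax * (A + a₂) * ξ * (C - fstar) := by
        rw [hν]
        nlinarith [mul_le_mul_of_nonneg_left (hPL w) hηmax.le]
    _ ≤ max ν b₂ * (F w - fstar) + max ν b₂ * (a₂ * ηmax * (C - fstar)) :=
        add_le_add (mul_le_mul_of_nonneg_right (le_max_left _ _) (sub_nonneg.2 (hFstar w)))
          (hb₂_le.trans (mul_le_mul_of_nonneg_right (le_max_right _ _) hGap))
    _ = _ := by ring
end
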